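/- Let n ≥ 1 and p ∈ (1, ∞). Then the set {div X : X ∈ C_c^∞(ℝⁿ, ℝⁿ)} of divergences of smooth compactly supported vector fields on ℝⁿ is dense in L^p(ℝⁿ). -/

import Mathlib

open MeasureTheory
open scoped ENNReal

/-- The divergence `div X = ∑ i, ∂Xᵢ/∂xᵢ` of a vector field `X` on `ℝⁿ`. -/
noncomputable def divergence {n : ℕ}
    (X : EuclideanSpace ℝ (Fin n) → EuclideanSpace ℝ (Fin n))
    (x : EuclideanSpace ℝ (Fin n)) : ℝ :=
  ∑ i : Fin n, fderiv ℝ (fun y => X y i) x (EuclideanSpace.single i 1)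

/-- The divergence of a vector field pointing in a fixed coordinate direction is a partial
derivative. -/
theorem divergence_smul_single {n : ℕ} {F : EuclideanSpace ℝ (Fin n) → ℝ}
    {x : EuclideanSpace ℝ (Fin n)} (hF : DifferentiableAt ℝ F x) (k : Fin n) :
    divergence (fun y => F y • EuclideanSpace.single k (1 : ℝ)) x =
      lineDeriv ℝ F x (EuclideanSpace.single k 1) := by
  rw [hF.lineDeriv_eq_fderiv, divergence, Finset.sum_eq_single k]
  · simp
  · intro i _ hik
    simp [hik]
  · simp

section SegmentIntegral

variable {E : Type*} [NormedAddCommGroup E] [NormedSpace ℝ E]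

/-- Integrals of a smooth compactly supported function along translates of a segment depend
smoothly on the base point. -/
theorem contDiff_integral_sub_smul {g : E → ℝ} (hg : ContDiff ℝ (⊤ : ℕ∞) g)
    (hgc : HasCompactSupport g) (e : E) {h : ℝ} (hh : 0 ≤ h) :
    ContDiff ℝ (⊤ : ℕ∞) (fun x => ∫ s in (0 : ℝ)..h, g (x - s • e)) := by
  borelize E
  let μ : Measure E := (volume.restrict (Set.Ioc 0 h)).map (fun s : ℝ => s • e)
  have hgcont := hg.continuous
  have hloc : LocallyIntegrable (fun _ : E => (1 : ℝ)) μ :=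
    (integrable_const (1 : ℝ)).locallyIntegrable
  convert hgc.contDiff_convolution_right (ContinuousLinearMap.lsmul ℝ ℝ) hloc hg using 1
  ext x
  rw [convolution_def, intervalIntegral.integral_of_le hh, MeasureTheory.integral_map]
  · simp
  · exact (by fun_prop : Continuous fun s : ℝ => s • e).aemeasurable
  · have hc : Continuous fun t : E => ((ContinuousLinearMap.lsmul ℝ ℝ) (1 : ℝ)) (g (x - t)) := by
      fun_prop
    exact (hc.stronglyMeasurable_of_hasCompactSupport (by
      have := hgc.comp_homeomorph (Homeomorph.subLeft x)
      simpa using! this)).aestronglyMeasurable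

/-- Integrals of a compactly supported function along translates of a segment vanish outside
a compact set of base points. -/
theorem hasCompactSupport_integral_sub_smul {g : E → ℝ} (hgc : HasCompactSupport g) (e : E)
    (h : ℝ) : HasCompactSupport (fun x => ∫ s in (0 : ℝ)..h, g (x - s • e)) := by
  have hK : IsCompact ((fun q : ℝ × E => q.2 + q.1 • e) '' (Set.uIcc 0 h ×ˢ tsupport g)) :=
    (isCompact_uIcc.prod hgc).image (by fun_prop)
  refine HasCompactSupport.intro hK fun x hx => ?_
  rw [intervalIntegral.integral_congr (g := fun _ => (0 : ℝ)), intervalIntegral.integral_zero]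
  intro s hs
  by_contra hne
  exact hx ⟨(s, x - s • e), ⟨hs, subset_tsupport _ hne⟩, by simp⟩

/-- The derivative of the integral over a translated segment in the direction of the segment. -/
theorem hasLineDerivAt_integral_sub_smul {g : E → ℝ} (hg : Continuous g) (e : E) (h : ℝ) (x : E) :
    HasLineDerivAt ℝ (fun x => ∫ s in (0 : ℝ)..h, g (x - s • e)) (g x - g (x - h • e)) x e := by
  have hφ : Continuous fun u : ℝ => g (x + u • e) := by fun_prop
  have hprim : ∀ t : ℝ, (∫ s in (0 : ℝ)..h, g (x + t • e - s • e)) =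
      (∫ u in (0 : ℝ)..t, g (x + u • e)) - ∫ u in (0 : ℝ)..(t - h), g (x + u • e) := by
    intro t
    rw [intervalIntegral.integral_interval_sub_left (hφ.intervalIntegrable _ _)
      (hφ.intervalIntegrable _ _)]
    have := intervalIntegral.integral_comp_sub_left (a := 0) (b := h)
      (fun u : ℝ => g (x + u • e)) t
    simp only [sub_zero] at this
    rw [← this]
    simp only [sub_smul, add_sub_assoc]
  unfold HasLineDerivAt
  simp only [hprim]
  have h1 := (hφ.integral_hasStrictDerivAt 0 0).hasDerivAt
  have h2 := (hφ.integral_hasStrictDerivAt 0 (0 - h)).hasDerivAt.comp_sub_const 0 h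
  convert! h1.sub h2 using 1
  simp [sub_eq_add_neg]

end SegmentIntegral

/-- An `L^p` bound for a sum of `N` functions with disjoint supports and seminorms at most `C`. -/
theorem eLpNorm_sum_le_of_disjoint {α : Type*} [MeasurableSpace α] {μ : Measure α} {p : ℝ≥0∞}
    (hp0 : p ≠ 0) (hp : p ≠ ⊤) {N : ℕ} {f : ℕ → α → ℝ} {C : ℝ≥0∞}
    (hf : ∀ i, AEStronglyMeasurable (f i) μ)
    (hdisj : ∀ i j x, f i x ≠ 0 → f j x ≠ 0 → i = j) (hC : ∀ i, eLpNorm (f i) p μ ≤ C) :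
    eLpNorm (fun x => ∑ i ∈ Finset.range N, f i x) p μ ≤ (N : ℝ≥0∞) ^ (1 / p.toReal) * C := by
  have hpos : 0 < p.toReal := ENNReal.toReal_pos hp0 hp
  have hpt : ∀ x, ‖∑ i ∈ Finset.range N, f i x‖ₑ ^ p.toReal ≤
      ∑ i ∈ Finset.range N, ‖f i x‖ₑ ^ p.toReal := by
    intro x
    by_cases hx : ∃ i ∈ Finset.range N, f i x ≠ 0
    · obtain ⟨i, hi, hix⟩ := hx
      rw [Finset.sum_eq_single_of_mem i hi fun j _ hji => by
        by_contra hj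
        exact hji (hdisj j i x hj hix)]
      exact Finset.single_le_sum (f := fun i => ‖f i x‖ₑ ^ p.toReal) (fun _ _ => zero_le) hi
    · push Not at hx
      rw [Finset.sum_eq_zero hx]
      simp [hpos]
  rw [← ENNReal.rpow_le_rpow_iff hpos, ENNReal.mul_rpow_of_nonneg _ _ hpos.le,
    ← ENNReal.rpow_mul, one_div, inv_mul_cancel₀ hpos.ne', ENNReal.rpow_one,
    eLpNorm_eq_eLpNorm' hp0 hp, ← lintegral_rpow_enorm_eq_rpow_eLpNorm' hpos]
  calc ∫⁻ x, ‖∑ i ∈ Finset.range N, f i x‖ₑ ^ p.toReal ∂μ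
      ≤ ∫⁻ x, ∑ i ∈ Finset.range N, ‖f i x‖ₑ ^ p.toReal ∂μ := lintegral_mono hpt
    _ = ∑ i ∈ Finset.range N, ∫⁻ x, ‖f i x‖ₑ ^ p.toReal ∂μ :=
      lintegral_finsetSum' _ fun i _ => (hf i).enorm.pow_const _
    _ ≤ ∑ i ∈ Finset.range N, C ^ p.toReal := by
      refine Finset.sum_le_sum fun i _ => ?_
      rw [lintegral_rpow_enorm_eq_rpow_eLpNorm' hpos, ← eLpNorm_eq_eLpNorm' hp0 hp]
      exact ENNReal.rpow_le_rpow (hC i) hpos.le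
    _ = N * C ^ p.toReal := by simp

/-- Translates of a function supported in a ball of radius `r` by distinct multiples of a vector
of length at least `2 * r` have disjoint supports. -/
theorem eq_of_ne_zero_of_support_subset_ball {E : Type*} [NormedAddCommGroup E] [NormedSpace ℝ E]
    {g : E → ℝ} {r : ℝ} (hr : Function.support g ⊆ Metric.ball 0 r) {v : E} (hv : 2 * r ≤ ‖v‖)
    {i j : ℕ} {x : E} (hi : g (x - (i : ℝ) • v) ≠ 0) (hj : g (x - (j : ℝ) • v) ≠ 0) : i = j := by
  have hi' := mem_ball_zero_iff.1 (hr hi)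
  have hj' := mem_ball_zero_iff.1 (hr hj)
  by_contra hne
  have hr0 : 0 < r := (norm_nonneg _).trans_lt hi'
  have h1 : (1 : ℝ) ≤ |(j : ℝ) - i| := by
    have : (1 : ℤ) ≤ |(j : ℤ) - i| := Int.one_le_abs (by omega)
    exact_mod_cast this
  have h2 : ‖((j : ℝ) - i) • v‖ < r + r := by
    have : ((j : ℝ) - i) • v = (x - (i : ℝ) • v) - (x - (j : ℝ) • v) := by
      rw [sub_smul]; abel
    rw [this]
    exact (norm_sub_le _ _).trans_lt (add_lt_add hi' hj')
  rw [norm_smul, Real.norm_eq_abs] at h2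
  nlinarith [norm_nonneg v]

/-- The difference between a smooth compactly supported function and an average of its translates
in a coordinate direction is the divergence of a smooth compactly supported vector field. -/
theorem exists_divergence_eq_sub_average {n : ℕ} (k : Fin n) {g : EuclideanSpace ℝ (Fin n) → ℝ}
    (hg : ContDiff ℝ (⊤ : ℕ∞) g) (hgc : HasCompactSupport g) {R : ℝ} (hR : 0 ≤ R) {N : ℕ}
    (hN : N ≠ 0) :
    ∃ X : EuclideanSpace ℝ (Fin n) → EuclideanSpace ℝ (Fin n),
      ContDiff ℝ (⊤ : ℕ∞) X ∧ HasCompactSupport X ∧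
      divergence X = fun x => g x - (N : ℝ)⁻¹ *
        ∑ j ∈ Finset.range N, g (x - (j : ℝ) • R • EuclideanSpace.single k (1 : ℝ)) := by
  set e : EuclideanSpace ℝ (Fin n) := EuclideanSpace.single k (1 : ℝ) with he
  let G : ℕ → EuclideanSpace ℝ (Fin n) → ℝ :=
    fun j x => ∫ s in (0 : ℝ)..(j * R), g (x - s • e)
  let F : EuclideanSpace ℝ (Fin n) → ℝ := fun x => ∑ j ∈ Finset.range N, (N : ℝ)⁻¹ * G j x
  have hG : ∀ j, ContDiff ℝ (⊤ : ℕ∞) (G j) := fun j =>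
    contDiff_integral_sub_smul hg hgc e (by positivity)
  have hF : ContDiff ℝ (⊤ : ℕ∞) F := ContDiff.sum fun j _ => contDiff_const.mul (hG j)
  have hFc : HasCompactSupport F := by
    have hK : IsCompact (⋃ j ∈ Finset.range N, tsupport (G j)) :=
      (Finset.range N).isCompact_biUnion fun j _ => hasCompactSupport_integral_sub_smul hgc e _
    refine HasCompactSupport.intro hK fun x hx => Finset.sum_eq_zero fun j hj => ?_
    simp only [Set.mem_iUnion, not_exists] at hx
    rw [image_eq_zero_of_notMem_tsupport (hx j hj), mul_zero]
  refine ⟨fun x => F x • e, hF.smul contDiff_const, hFc.smul_right, ?_⟩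
  ext x
  rw [he, divergence_smul_single (hF.differentiable (by simp) x) k, ← he]
  have hder : HasLineDerivAt ℝ F
      (∑ j ∈ Finset.range N, (N : ℝ)⁻¹ * (g x - g (x - ((j : ℝ) * R) • e))) x e :=
    HasDerivAt.fun_sum fun j _ =>
      HasDerivAt.const_mul _ (hasLineDerivAt_integral_sub_smul hg.continuous e _ x)
  rw [hder.lineDeriv, ← Finset.mul_sum, Finset.sum_sub_distrib]
  have hN' : (N : ℝ) ≠ 0 := Nat.cast_ne_zero.2 hN
  simp [mul_sub, smul_smul, hN']

/-- For `n ≥ 1` and `p ∈ (1, ∞)`, the set of divergences of smooth compactly supported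
vector fields on `ℝⁿ` is dense in `L^p(ℝⁿ)`. -/
theorem dense_divergence_Lp (n : ℕ) (hn : 1 ≤ n) (p : ℝ≥0∞) (hp1 : 1 < p) (hp : p ≠ ⊤) :
    haveI : Fact (1 ≤ p) := ⟨hp1.le⟩
    Dense {f : Lp ℝ p (volume : Measure (EuclideanSpace ℝ (Fin n))) |
      ∃ X : EuclideanSpace ℝ (Fin n) → EuclideanSpace ℝ (Fin n),
        ContDiff ℝ (⊤ : ℕ∞) X ∧ HasCompactSupport X ∧
        (f : EuclideanSpace ℝ (Fin n) → ℝ) =ᵐ[volume] divergence X} := by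
  have : Fact (1 ≤ p) := ⟨hp1.le⟩
  have hp0 : p ≠ 0 := (zero_lt_one.trans hp1).ne'
  have hpr : 1 < p.toReal := by
    rw [← ENNReal.toReal_one]
    exact (ENNReal.toReal_lt_toReal ENNReal.one_ne_top hp).2 hp1
  refine Dense.of_closure ((Lp.dense_hasCompactSupport_contDiff hp).mono ?_)
  rintro f ⟨g, hfg, hgc, hg⟩
  let k : Fin n := ⟨0, hn⟩
  obtain ⟨r, hr0, hr⟩ := hgc.isCompact.isBounded.subset_ball_lt 0 0
  let v : EuclideanSpace ℝ (Fin n) := (2 * r) • EuclideanSpace.single k (1 : ℝ)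
  have hv : 2 * r ≤ ‖v‖ := by
    simp [v, norm_smul, abs_of_pos hr0]
  have hgL : MemLp g p volume := hg.continuous.memLp_of_hasCompactSupport hgc
  let T : ℕ → EuclideanSpace ℝ (Fin n) → ℝ := fun j x => g (x - (j : ℝ) • v)
  have hT : ∀ j, MemLp (T j) p volume := fun j =>
    hgL.comp_measurePreserving (measurePreserving_sub_right volume ((j : ℝ) • v))
  have hTnorm : ∀ j, eLpNorm (T j) p volume ≤ eLpNorm g p volume := fun j =>
    (eLpNorm_comp_measurePreserving hgL.aestronglyMeasurable
      (measurePreserving_sub_right volume ((j : ℝ) • v))).le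
  let A : ℕ → EuclideanSpace ℝ (Fin n) → ℝ :=
    fun N x => (N : ℝ)⁻¹ * ∑ j ∈ Finset.range N, T j x
  have hA : ∀ N, MemLp (A N) p volume := fun N =>
    (memLp_finsetSum _ fun j _ => hT j).const_mul _
  have hAnorm : ∀ N : ℕ, ‖(hA N).toLp‖ ≤
      (N : ℝ)⁻¹ * ((N : ℝ) ^ (1 / p.toReal) * (eLpNorm g p volume).toReal) := by
    intro N
    have hsum := eLpNorm_sum_le_of_disjoint (N := N) hp0 hp
      (fun j => (hT j).aestronglyMeasurable)
      (fun i j x => eq_of_ne_zero_of_support_subset_ball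
        ((subset_tsupport g).trans hr) hv) hTnorm
    have hfin : (N : ℝ≥0∞) ^ (1 / p.toReal) * eLpNorm g p volume ≠ ⊤ :=
      ENNReal.mul_ne_top (ENNReal.rpow_ne_top_of_nonneg (by positivity)
        (ENNReal.natCast_ne_top N)) hgL.eLpNorm_ne_top
    have hAeq : eLpNorm (A N) p volume = ‖(N : ℝ)⁻¹‖ₑ *
        eLpNorm (fun x => ∑ j ∈ Finset.range N, T j x) p volume :=
      eLpNorm_const_smul (N : ℝ)⁻¹ (fun x => ∑ j ∈ Finset.range N, T j x) p volume
    rw [Lp.norm_toLp, hAeq, ENNReal.toReal_mul, toReal_enorm, norm_inv, Real.norm_natCast]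
    have := ENNReal.toReal_mono hfin hsum
    rw [ENNReal.toReal_mul, ← ENNReal.toReal_rpow, ENNReal.toReal_natCast] at this
    gcongr
  have hlim : Filter.Tendsto (fun N => (hA N).toLp) Filter.atTop (nhds 0) := by
    refine squeeze_zero_norm' (Filter.Eventually.of_forall hAnorm) ?_
    have hexp : 0 < 1 - 1 / p.toReal := by
      rw [sub_pos, div_lt_one (by positivity)]
      exact hpr
    have h0 := ((tendsto_rpow_neg_atTop hexp).comp
      tendsto_natCast_atTop_atTop).mul_const (eLpNorm g p volume).toReal
    rw [zero_mul] at h0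
    refine h0.congr' ?_
    filter_upwards [Filter.eventually_gt_atTop 0] with N hN
    have hN' : (0 : ℝ) < N := Nat.cast_pos.2 hN
    rw [Function.comp_apply, ← mul_assoc, ← Real.rpow_neg_one, ← Real.rpow_add hN']
    congr 2
    ring
  have hlim' : Filter.Tendsto (fun N => f - (hA N).toLp) Filter.atTop (nhds f) := by
    simpa using hlim.const_sub f
  refine mem_closure_of_tendsto hlim' ?_
  filter_upwards [Filter.eventually_ne_atTop 0] with N hN
  obtain ⟨X, hX, hXc, hdiv⟩ := exists_divergence_eq_sub_average k hg hgc (R := 2 * r)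
    (by positivity) hN
  refine ⟨X, hX, hXc, ?_⟩
  filter_upwards [Lp.coeFn_sub f (hA N).toLp, hfg, (hA N).coeFn_toLp] with x h1 h2 h3
  rw [h1, Pi.sub_apply, h2, h3, hdiv]
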